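/- Assume the Riemann hypothesis. Fix y > 0 and δ ∈ (1/2, 1). Let S be the set of positive integers N with N ≢ 2 (mod 4) such that N is either prime or squarefull, and define f(X) = Σ_{N ∈ S, N ≤ X} φ(N)/N. Then lim_{X → ∞} (1/(f(X + X^δ) − f(X))) · Σ_{N ∈ S, X ≤ N ≤ X + X^δ} Σ_{χ ∈ D₊(N)} χ(⌈yX⌉^𝔭)/τ(χ) = cos(2πy). -/

import Mathlib

open Filter Topology Finset
open scoped Classical

/-- The Riemann hypothesis: every zero of the Riemann zeta function with real part
strictly between `0` and `1` has real part `1/2`. -/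
def RiemannHypothesis' : Prop :=
  ∀ s : ℂ, riemannZeta s = 0 → 0 < s.re → s.re < 1 → s.re = 1 / 2

/-- `⌈x⌉^𝔭`: the smallest prime number that is `≥ x`. -/
noncomputable def leastPrime (x : ℝ) : ℕ := sInf {p : ℕ | p.Prime ∧ x ≤ (p : ℝ)}

/-- The Gauss sum `τ(χ) = Σ_{b=1}^{N} χ(b) e^{2πib/N}`. -/
noncomputable def gaussSum' {N : ℕ} (χ : DirichletCharacter ℂ N) : ℂ :=
  ∑ b ∈ Finset.Icc 1 N,
    χ ((b : ℕ) : ZMod N) * Complex.exp (2 * Real.pi * Complex.I * (b : ℂ) / (N : ℂ))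

/-- A positive integer is squarefull if every prime factor occurs with exponent
at least `2`. -/
def IsSquarefull (n : ℕ) : Prop := ∀ p : ℕ, p.Prime → p ∣ n → p ^ 2 ∣ n

/-- Membership in the set `S` of positive integers `N ≢ 2 (mod 4)` that are either
prime or squarefull. -/
def memS (N : ℕ) : Prop := 0 < N ∧ N % 4 ≠ 2 ∧ (N.Prime ∨ IsSquarefull N)

/-- `f(X) = Σ_{N ∈ S, N ≤ X} φ(N)/N`. -/
noncomputable def fS (X : ℝ) : ℝ :=
  ∑ N ∈ (Finset.range (Nat.floor X + 1)).filter
      (fun N : ℕ => memS N ∧ (N : ℝ) ≤ X),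
    (Nat.totient N : ℝ) / N


section GaussSums

open ZMod DirichletCharacter

variable {N : ℕ} [NeZero N]

lemma sum_Icc_natCast_zmod (g : ZMod N → ℂ) :
    ∑ b ∈ Finset.Icc 1 N, g ((b : ℕ) : ZMod N) = ∑ a : ZMod N, g a := by
  refine Finset.sum_nbij (fun b : ℕ => (b : ZMod N)) (by simp) ?_ ?_ (by simp)
  · intro a ha b hb hab
    simp only [Finset.coe_Icc, Set.mem_Icc] at ha hb
    have hab' : ((a : ℕ) : ZMod N) = (b : ZMod N) := hab
    rw [ZMod.natCast_eq_natCast_iff] at hab'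
    have h1 : (a - 1) ≡ (b - 1) [MOD N] := by
      refine Nat.ModEq.add_right_cancel' 1 ?_
      rwa [Nat.sub_add_cancel ha.1, Nat.sub_add_cancel hb.1]
    have := Nat.ModEq.eq_of_lt_of_lt h1 (by omega) (by omega)
    omega
  · intro a _
    have hN := NeZero.pos N
    by_cases h : a = 0
    · exact ⟨N, by simp; omega, by simp [h]⟩
    · refine ⟨a.val, ?_, by simp⟩
      have h1 := ZMod.val_lt a
      have h2 : a.val ≠ 0 := by simpa using h
      simp only [Finset.coe_Icc, Set.mem_Icc]
      omega

lemma gaussSum'_eq_gaussSum (χ : DirichletCharacter ℂ N) :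
    gaussSum' χ = gaussSum χ stdAddChar := by
  rw [gaussSum, ← sum_Icc_natCast_zmod, gaussSum']
  refine Finset.sum_congr rfl fun b _ => ?_
  have := stdAddChar_coe (N := N) (b : ℤ)
  push_cast at this
  rw [this]

lemma gaussSum_mul_gaussSum_inv_of_even {χ : DirichletCharacter ℂ N} (hχ : χ.IsPrimitive)
    (he : χ (-1) = 1) :
    gaussSum χ stdAddChar * gaussSum χ⁻¹ stdAddChar = N := by
  have h := congrFun (ZMod.dft_dft (fun a => χ a)) (-1)
  have he' : χ⁻¹ (-1) = 1 := by
    rw [MulChar.inv_apply_eq_inv', he, inv_one]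
  rw [ZMod.dft_apply] at h
  simp only [neg_neg, map_one, smul_eq_mul, mul_one] at h
  rw [← h, gaussSum, mul_comm, gaussSum, Finset.sum_mul]
  refine Finset.sum_congr rfl fun j _ => ?_
  have h1 := hχ.fourierTransform_eq_inv_mul_gaussSum j
  rw [h1, neg_eq_neg_one_mul j, map_mul, he', gaussSum]
  simp only [mul_neg, one_mul, neg_neg, mul_one]
  ring

lemma sum_char_mul_gaussSum_inv (u : (ZMod N)ˣ) :
    ∑ χ : DirichletCharacter ℂ N, χ u * gaussSum χ⁻¹ stdAddChar
      = (N.totient : ℂ) * stdAddChar (u : ZMod N) := by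
  rw [← Equiv.sum_comp (Equiv.inv (DirichletCharacter ℂ N))]
  simp only [Equiv.inv_apply, inv_inv, gaussSum, Finset.mul_sum]
  rw [Finset.sum_comm]
  have key (b : ZMod N) : ∑ χ : DirichletCharacter ℂ N, χ⁻¹ u * (χ b * stdAddChar b)
      = if b = u then (N.totient : ℂ) * stdAddChar (u : ZMod N) else 0 := by
    have h1 (χ : DirichletCharacter ℂ N) : χ⁻¹ u * (χ b * stdAddChar b)
        = χ (((u⁻¹ : (ZMod N)ˣ) : ZMod N) * b) * stdAddChar b := by
      rw [MulChar.inv_apply, Ring.inverse_unit, map_mul, mul_assoc]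
    simp_rw [h1]
    rw [← Finset.sum_mul, sum_characters_eq]
    have h2 : ((u⁻¹ : (ZMod N)ˣ) : ZMod N) * b = 1 ↔ b = u := by
      rw [Units.inv_mul_eq_iff_eq_mul, mul_one]
    simp only [h2]
    split_ifs with h
    · rw [h]
    · simp
  rw [Finset.sum_congr rfl fun b _ => key b]
  simp

lemma sum_even_char_mul_gaussSum_inv (u : (ZMod N)ˣ) :
    ∑ χ : DirichletCharacter ℂ N with χ (-1) = 1, χ u * gaussSum χ⁻¹ stdAddChar
      = (N.totient : ℂ) / 2 * (stdAddChar (u : ZMod N) + stdAddChar (-(u : ZMod N))) := by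
  have h1 := sum_char_mul_gaussSum_inv u
  have h2 := sum_char_mul_gaussSum_inv (-u)
  rw [Units.val_neg] at h2
  have : (N.totient : ℂ) / 2 * (stdAddChar (u : ZMod N) + stdAddChar (-(u : ZMod N)))
      = ((N.totient : ℂ) * stdAddChar (u : ZMod N)
        + (N.totient : ℂ) * stdAddChar (-(u : ZMod N))) / 2 := by ring
  rw [this, ← h1, ← h2, ← Finset.sum_add_distrib, Finset.sum_filter, Finset.sum_div]
  refine Finset.sum_congr rfl fun χ _ => ?_
  rw [neg_eq_neg_one_mul (u : ZMod N), map_mul]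
  rcases χ.even_or_odd with h | h
  · have h' : χ (-1) = 1 := h
    rw [if_pos h', h']; ring
  · have h' : χ (-1) = -1 := h
    rw [if_neg (by rw [h']; norm_num), h']; ring

lemma stdAddChar_natCast_add_neg (p : ℕ) :
    (stdAddChar ((p : ℕ) : ZMod N) + stdAddChar (-((p : ℕ) : ZMod N)) : ℂ)
      = 2 * Real.cos (2 * Real.pi * (p / N)) := by
  have h1 := stdAddChar_coe (N := N) (p : ℤ)
  have h2 := stdAddChar_coe (N := N) (-(p : ℤ))
  push_cast at h1 h2 ⊢
  rw [h1, h2, Complex.two_cos]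
  congr 2 <;> ring

/-- The Gauss sum of an imprimitive character to a squarefull modulus vanishes. -/
lemma gaussSum_eq_zero_of_isSquarefull (hN : IsSquarefull N) {χ : DirichletCharacter ℂ N}
    (hχ : ¬ χ.IsPrimitive) : gaussSum χ stdAddChar = 0 := by
  obtain ⟨k, hk⟩ := χ.conductor_dvd_level
  have hk1 : k ≠ 1 := by
    rintro rfl
    exact hχ (by rw [isPrimitive_def]; simpa using hk.symm)
  obtain ⟨q, hq, l, rfl⟩ := Nat.exists_prime_and_dvd hk1
  set d := χ.conductor
  set M := d * l with hM
  have hNM : N = M * q := by rw [hk, hM]; ring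
  have hqM : q ∣ M := by
    have := hN q hq ⟨M, by rw [hNM, mul_comm]⟩
    rw [hNM, sq] at this
    exact Nat.dvd_of_mul_dvd_mul_right hq.pos this
  have hMN : M ∣ N := ⟨q, hNM⟩
  have hfac : χ.FactorsThrough M :=
    FactorsThrough.mono χ χ.factorsThrough_conductor ⟨l, hM⟩ hMN
  have hshift (b : ZMod N) : χ (b + (M : ℕ)) = χ b := by
    have hunit : IsUnit (b + ((M : ℕ) : ZMod N)) ↔ IsUnit b := by
      have hnil : IsNilpotent ((M : ℕ) : ZMod N) := by
        refine ⟨2, ?_⟩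
        rw [← Nat.cast_pow, ZMod.natCast_eq_zero_iff, sq, hNM]
        exact Nat.mul_dvd_mul_left M hqM
      constructor
      · intro h
        have := IsNilpotent.isUnit_add_left_of_commute hnil.neg h (Commute.all _ _)
        simpa using this
      · intro h
        exact IsNilpotent.isUnit_add_left_of_commute hnil h (Commute.all _ _)
    by_cases hb : IsUnit b
    · obtain ⟨b', hb'⟩ := hb
      obtain ⟨c', hc'⟩ := hunit.2 ⟨b', hb'⟩
      rw [← hc', ← hb', hfac.eq_changeLevel, changeLevel_eq_cast_of_dvd,
        changeLevel_eq_cast_of_dvd, hc', hb', ZMod.cast_add hMN, ZMod.cast_natCast hMN,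
        ZMod.natCast_self, add_zero]
    · rw [MulChar.map_nonunit _ hb, MulChar.map_nonunit _ (fun h => hb (hunit.1 h))]
  have hne : (stdAddChar ((M : ℕ) : ZMod N) : ℂ) ≠ 1 := by
    intro h
    rw [← (stdAddChar (N := N)).map_zero_eq_one] at h
    have := injective_stdAddChar h
    rw [ZMod.natCast_eq_zero_iff] at this
    have hM0 : 0 < M := Nat.pos_of_ne_zero fun h0 =>
      NeZero.ne N (by simpa [h0] using hNM)
    have h3 := Nat.le_of_dvd hM0 this
    rw [hNM] at h3
    have := hq.two_le
    nlinarith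
  have hsum : gaussSum χ stdAddChar
      = gaussSum χ stdAddChar * stdAddChar ((M : ℕ) : ZMod N) := by
    conv_lhs => rw [gaussSum, ← Equiv.sum_comp (Equiv.addRight ((M : ℕ) : ZMod N))]
    rw [gaussSum, Finset.sum_mul]
    refine Finset.sum_congr rfl fun b _ => ?_
    simp only [Equiv.coe_addRight]
    rw [hshift, AddChar.map_add_eq_mul, mul_assoc]
  have : gaussSum χ stdAddChar * (1 - stdAddChar ((M : ℕ) : ZMod N)) = 0 := by
    rw [mul_sub, ← hsum]; ring
  rcases mul_eq_zero.1 this with h | h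
  · exact h
  · exact absurd (sub_eq_zero.1 h).symm hne

/-- The inner sum `Σ_{χ ∈ D₊(N)} χ(p)/τ(χ)` as a sum over even primitive characters. -/
lemma finsum_even_primitive_eq (p : ℕ) :
    ∑ᶠ χ ∈ {χ : DirichletCharacter ℂ N | χ.IsPrimitive ∧ χ (-1) = 1},
        χ ((p : ℕ) : ZMod N) / gaussSum' χ
      = (∑ χ : DirichletCharacter ℂ N with χ (-1) = 1 ∧ χ.IsPrimitive,
          χ ((p : ℕ) : ZMod N) * gaussSum χ⁻¹ stdAddChar) / N := by
  rw [finsum_mem_eq_finite_toFinset_sum _ (Set.toFinite _), Finset.sum_div]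
  refine Finset.sum_congr (by ext; simp [and_comm]) fun χ hχ => ?_
  simp only [Finset.mem_filter, Finset.mem_univ, true_and] at hχ
  have h := gaussSum_mul_gaussSum_inv_of_even hχ.2 hχ.1
  have hN : (N : ℂ) ≠ 0 := NeZero.ne _
  have h0 : gaussSum χ stdAddChar ≠ 0 := by
    intro h0; rw [h0, zero_mul] at h; exact hN h.symm
  rw [gaussSum'_eq_gaussSum, div_eq_div_iff h0 hN, ← h]
  ring

lemma finsum_even_primitive_of_isSquarefull (hN : IsSquarefull N) {p : ℕ}
    (hp : p.Coprime N) :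
    ∑ᶠ χ ∈ {χ : DirichletCharacter ℂ N | χ.IsPrimitive ∧ χ (-1) = 1},
        χ ((p : ℕ) : ZMod N) / gaussSum' χ
      = ((N.totient / N * Real.cos (2 * Real.pi * (p / N)) : ℝ) : ℂ) := by
  rw [finsum_even_primitive_eq, ← Finset.filter_filter, Finset.sum_filter]
  have h1 := sum_even_char_mul_gaussSum_inv (ZMod.unitOfCoprime p hp)
  rw [ZMod.coe_unitOfCoprime, stdAddChar_natCast_add_neg] at h1
  have h2 : ∀ χ : DirichletCharacter ℂ N,
      (if χ.IsPrimitive then χ ((p : ℕ) : ZMod N) * gaussSum χ⁻¹ stdAddChar else 0)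
        = χ ((p : ℕ) : ZMod N) * gaussSum χ⁻¹ stdAddChar := by
    intro χ
    split_ifs with h
    · rfl
    · rw [gaussSum_eq_zero_of_isSquarefull hN (χ := χ⁻¹), mul_zero]
      rwa [isPrimitive_def, conductor_inv]
  simp_rw [h2]
  rw [h1]
  push_cast
  ring

lemma finsum_even_primitive_of_prime (hN : N.Prime) {p : ℕ} (hp : p.Coprime N) :
    ∑ᶠ χ ∈ {χ : DirichletCharacter ℂ N | χ.IsPrimitive ∧ χ (-1) = 1},
        χ ((p : ℕ) : ZMod N) / gaussSum' χ
      = ((N.totient / N * Real.cos (2 * Real.pi * (p / N)) + 1 / N : ℝ) : ℂ) := by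
  rw [finsum_even_primitive_eq]
  have h1 := sum_even_char_mul_gaussSum_inv (ZMod.unitOfCoprime p hp)
  rw [ZMod.coe_unitOfCoprime, stdAddChar_natCast_add_neg] at h1
  have h3 : (Finset.univ.filter fun χ : DirichletCharacter ℂ N => χ (-1) = 1 ∧ χ.IsPrimitive)
      = (Finset.univ.filter fun χ : DirichletCharacter ℂ N => χ (-1) = 1).erase 1 := by
    ext χ
    simp only [Finset.mem_filter, Finset.mem_univ, true_and, Finset.mem_erase]
    rw [and_comm]
    refine and_congr_left fun _ => ?_
    rw [isPrimitive_def, Ne, eq_one_iff_conductor_eq_one]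
    rcases (Nat.dvd_prime hN).1 χ.conductor_dvd_level with h | h
    · simp [h, hN.ne_one.symm]
    · simp [h, hN.ne_one]
  have : Fact N.Prime := ⟨hN⟩
  have h4 : gaussSum (1 : DirichletCharacter ℂ N)⁻¹ stdAddChar = -1 := by
    rw [inv_one]
    refine gaussSum_one_left fun h => ?_
    have := (isPrimitive_stdAddChar N) one_ne_zero
    rw [h] at this
    exact this (by ext; simp)
  have h5 : (1 : DirichletCharacter ℂ N) ((p : ℕ) : ZMod N) = 1 :=
    MulChar.one_apply ((ZMod.isUnit_iff_coprime p N).2 hp)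
  have h6 := Finset.add_sum_erase (Finset.univ.filter
    fun χ : DirichletCharacter ℂ N => χ (-1) = 1)
    (fun χ => χ ((p : ℕ) : ZMod N) * gaussSum χ⁻¹ stdAddChar) (a := 1)
    (by simp [MulChar.one_apply (isUnit_one.neg)])
  rw [h1, h4, h5] at h6
  rw [h3, eq_sub_of_add_eq' h6]
  push_cast
  ring

lemma finsum_even_primitive_self (hN : N ≠ 1) :
    ∑ᶠ χ ∈ {χ : DirichletCharacter ℂ N | χ.IsPrimitive ∧ χ (-1) = 1},
        χ ((N : ℕ) : ZMod N) / gaussSum' χ = 0 := by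
  rw [finsum_even_primitive_eq]
  simp [map_zero' _ hN]

end GaussSums

section Kernel

open MeasureTheory Real

/-- A continuous even function supported on `[-π, π]` whose Fourier transform is integrable, has
positive integral and is nonpositive outside `[-2, 2]`. -/
noncomputable def tent (t : ℝ) : ℝ :=
  3 * sin (min |t| π) + (π - min |t| π) * cos (min |t| π)

/-- The cosine transform of `tent`. -/
noncomputable def tentHat (v : ℝ) : ℝ := ∫ t in (-π)..π, tent t * cos (t * v)

lemma continuous_tent : Continuous tent := by
  unfold tent
  fun_prop

lemma tent_neg (t : ℝ) : tent (-t) = tent t := by simp [tent]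

lemma tent_zero : tent 0 = π := by simp [tent, pi_pos.le]

lemma tent_of_pi_le {t : ℝ} (ht : π ≤ |t|) : tent t = 0 := by simp [tent, min_eq_right ht]

lemma tent_of_mem {t : ℝ} (h0 : 0 ≤ t) (h1 : t ≤ π) :
    tent t = 3 * sin t + (π - t) * cos t := by
  simp [tent, abs_of_nonneg h0, min_eq_left h1]

lemma integral_eq_two_mul_of_even {f : ℝ → ℝ} (hf : Continuous f) (he : ∀ t, f (-t) = f t)
    (a : ℝ) : ∫ t in (-a)..a, f t = 2 * ∫ t in (0 : ℝ)..a, f t := by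
  rw [← intervalIntegral.integral_add_adjacent_intervals (b := 0) (hf.intervalIntegrable _ _)
    (hf.intervalIntegrable _ _)]
  have := intervalIntegral.integral_comp_neg (f := f) (a := 0) (b := a)
  simp only [he, neg_zero] at this
  rw [← this]
  ring

lemma tentHat_eq {v : ℝ} (hv : 1 - v ^ 2 ≠ 0) :
    tentHat v = 4 * (2 - v ^ 2) * (1 + cos (π * v)) / (1 - v ^ 2) ^ 2 := by
  rw [tentHat, integral_eq_two_mul_of_even (by have := continuous_tent; fun_prop)
    (by intro t; simp [tent_neg])]
  set D := 1 - v ^ 2 with hD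
  have hder : ∀ t ∈ Set.uIcc 0 π, HasDerivAt (fun t : ℝ =>
      3 * (-(v * (sin t * sin (t * v)) + cos t * cos (t * v)) / D)
      + (π - t) * ((sin t * cos (t * v) - v * (cos t * sin (t * v))) / D)
      + (-(v * (sin t * sin (t * v)) + cos t * cos (t * v)) / D
        - v * ((sin t * sin (t * v) + v * (cos t * cos (t * v))) / D)) / D)
      (tent t * cos (t * v)) t := by
    intro t ht
    rw [Set.uIcc_of_le pi_pos.le] at ht
    rw [tent_of_mem ht.1 ht.2]
    have hid : HasDerivAt (fun t : ℝ => t * v) v t := by simpa using (hasDerivAt_id t).mul_const v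
    have hs := hasDerivAt_sin t
    have hc := hasDerivAt_cos t
    have hsv := hid.sin
    have hcv := hid.cos
    have hss := hs.mul hsv
    have hcc := hc.mul hcv
    have hsc := hs.mul hcv
    have hcs := hc.mul hsv
    have hA := (((hss.const_mul v).add hcc).neg).div_const D
    have hP := (hsc.sub (hcs.const_mul v)).div_const D
    have hB := (hss.add (hcc.const_mul v)).div_const D
    have hpt : HasDerivAt (fun t : ℝ => π - t) (-1) t := by
      simpa using (hasDerivAt_id t).const_sub π
    have hW := ((hA.const_mul 3).add (hpt.mul hP)).add ((hA.sub (hB.const_mul v)).div_const D)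
    refine hW.congr_deriv ?_
    simp only [Pi.mul_apply, Pi.sub_apply]
    field_simp
    rw [hD]
    ring
  rw [intervalIntegral.integral_eq_sub_of_hasDerivAt hder
    (by have := continuous_tent; exact (by fun_prop : Continuous _).intervalIntegrable _ _)]
  simp only [sin_pi, cos_pi, sin_zero, cos_zero, zero_mul, mul_zero, sub_self, zero_add, mul_one]
  field_simp
  rw [hD]
  ring

lemma abs_tent_le (t : ℝ) : |tent t| ≤ 3 + π := by
  have h1 := abs_sin_le_one (min |t| π)
  have h2 := abs_cos_le_one (min |t| π)
  have h3 : |π - min |t| π| ≤ π := by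
    rw [abs_of_nonneg (by simp)]
    have : 0 ≤ min |t| π := le_min (abs_nonneg t) pi_pos.le
    linarith
  calc |tent t| ≤ |3 * sin (min |t| π)| + |(π - min |t| π) * cos (min |t| π)| := abs_add_le _ _
    _ = 3 * |sin (min |t| π)| + |π - min |t| π| * |cos (min |t| π)| := by
        rw [abs_mul, abs_mul]; norm_num
    _ ≤ 3 * 1 + π * 1 := by gcongr
    _ = 3 + π := by ring

lemma abs_tentHat_le (v : ℝ) : |tentHat v| ≤ (3 + π) * (2 * π) := by
  have := intervalIntegral.norm_integral_le_of_norm_le_const (a := -π) (b := π)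
    (f := fun t => tent t * cos (t * v)) (C := 3 + π) (fun t _ => by
      rw [norm_eq_abs, abs_mul]
      calc |tent t| * |cos (t * v)| ≤ (3 + π) * 1 := by
            gcongr
            · exact abs_tent_le t
            · exact abs_cos_le_one _
        _ = 3 + π := mul_one _)
  rw [tentHat, ← norm_eq_abs]
  refine this.trans_eq ?_
  rw [abs_of_nonneg (by linarith [pi_pos])]
  ring

lemma tentHat_nonpos {v : ℝ} (hv : 2 ≤ |v|) : tentHat v ≤ 0 := by
  have h4 : 4 ≤ v ^ 2 := by rw [← sq_abs]; nlinarith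
  rw [tentHat_eq (by nlinarith)]
  have h1 := neg_one_le_cos (π * v)
  refine div_nonpos_of_nonpos_of_nonneg ?_ (sq_nonneg _)
  exact mul_nonpos_of_nonpos_of_nonneg (by linarith) (by linarith)

lemma continuous_tentHat : Continuous tentHat := by
  unfold tentHat
  have := continuous_tent
  exact intervalIntegral.continuous_parametric_intervalIntegral_of_continuous' (by fun_prop) _ _

lemma exists_abs_tentHat_le : ∃ C, ∀ v, |tentHat v| ≤ C * (1 + v ^ 2)⁻¹ := by
  refine ⟨5 * ((3 + π) * (2 * π)) + 20, fun v => ?_⟩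
  have hπ := pi_pos
  rw [← div_eq_mul_inv, le_div_iff₀ (by positivity)]
  rcases le_or_gt (v ^ 2) 4 with h | h
  · have := abs_tentHat_le v
    have h0 := abs_nonneg (tentHat v)
    nlinarith
  · have hD : 0 < (1 - v ^ 2) ^ 2 := by nlinarith
    rw [tentHat_eq (by nlinarith), abs_div, abs_mul, abs_mul, abs_of_pos hD,
      div_mul_eq_mul_div, div_le_iff₀ hD]
    have h1 : |1 + cos (π * v)| ≤ 2 := by
      rw [abs_le]; constructor <;> linarith [neg_one_le_cos (π * v), cos_le_one (π * v)]
    have h2 : |2 - v ^ 2| = v ^ 2 - 2 := by rw [abs_of_neg (by linarith)]; ring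
    rw [h2, abs_of_pos (by norm_num : (0 : ℝ) < 4)]
    have h3 : 4 * (v ^ 2 - 2) * |1 + cos (π * v)| * (1 + v ^ 2)
        ≤ 4 * (v ^ 2 - 2) * 2 * (1 + v ^ 2) := by
      have : 0 ≤ v ^ 2 - 2 := by linarith
      gcongr
    have h4 : 4 * (v ^ 2 - 2) * 2 * (1 + v ^ 2) ≤ 20 * (1 - v ^ 2) ^ 2 := by nlinarith
    have h5 : 0 ≤ 5 * ((3 + π) * (2 * π)) * (1 - v ^ 2) ^ 2 := by positivity
    linarith

lemma integrable_tentHat : Integrable tentHat := by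
  obtain ⟨C, hC⟩ := exists_abs_tentHat_le
  exact (integrable_inv_one_add_sq.const_mul C).mono' continuous_tentHat.aestronglyMeasurable
    (Filter.Eventually.of_forall hC)

lemma integral_tent_mul_cexp (v : ℝ) :
    ∫ t in (-π)..π, (tent t : ℂ) * Complex.exp (-(t * v) * Complex.I) = tentHat v := by
  have hct := continuous_tent
  have h1 : ∀ t : ℝ, (tent t : ℂ) * Complex.exp (-(t * v) * Complex.I)
      = ((tent t * cos (t * v) : ℝ) : ℂ) - ((tent t * sin (t * v) : ℝ) : ℂ) * Complex.I := by
    intro t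
    rw [Complex.exp_mul_I, Complex.cos_neg, Complex.sin_neg]
    push_cast
    ring
  simp_rw [h1]
  rw [intervalIntegral.integral_sub, intervalIntegral.integral_mul_const,
    intervalIntegral.integral_ofReal, intervalIntegral.integral_ofReal]
  · have hodd : ∫ t in (-π)..π, tent t * sin (t * v) = 0 := by
      have := intervalIntegral.integral_comp_neg (f := fun t => tent t * sin (t * v))
        (a := -π) (b := π)
      simp only [tent_neg, neg_mul, sin_neg, mul_neg, intervalIntegral.integral_neg,
        neg_neg] at this
      linarith
    rw [hodd]
    simp [tentHat]
  · exact (by fun_prop : Continuous _).intervalIntegrable _ _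
  · exact (by fun_prop : Continuous _).intervalIntegrable _ _

lemma integral_tent_mul_eq_interval (g : ℝ → ℂ) :
    ∫ t, (tent t : ℂ) * g t = ∫ t in (-π)..π, (tent t : ℂ) * g t := by
  rw [intervalIntegral.integral_of_le (by linarith [pi_pos]),
    setIntegral_eq_integral_of_forall_compl_eq_zero]
  intro t ht
  rw [tent_of_pi_le, Complex.ofReal_zero, zero_mul]
  by_contra! h
  exact ht ⟨(abs_lt.1 h).1, (abs_lt.1 h).2.le⟩

lemma integrable_tent : Integrable fun t => (tent t : ℂ) := by
  refine Continuous.integrable_of_hasCompactSupport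
    (by have := continuous_tent; fun_prop) ?_
  refine HasCompactSupport.intro (isCompact_Icc (a := -π) (b := π)) fun t ht => ?_
  rw [tent_of_pi_le, Complex.ofReal_zero]
  by_contra! h
  exact ht ⟨(abs_lt.1 h).1.le, (abs_lt.1 h).2.le⟩

open FourierTransform in
lemma integral_tentHat_pos : 0 < ∫ v, tentHat v := by
  have hF : 𝓕 (fun t => (tent t : ℂ)) = fun w => ((tentHat (2 * π * w) : ℝ) : ℂ) := by
    ext w
    rw [Real.fourier_real_eq_integral_exp_smul, ← integral_tent_mul_cexp,
      ← integral_tent_mul_eq_interval]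
    refine integral_congr_ae (Filter.Eventually.of_forall fun t => ?_)
    simp only [smul_eq_mul]
    rw [mul_comm]
    congr 2
    push_cast
    ring
  have h_int : Integrable (𝓕 (fun t => (tent t : ℂ))) := by
    rw [hF]
    exact (integrable_tentHat.comp_mul_left' (by positivity)).ofReal
  have hinv := congrFun (Continuous.fourierInv_fourier_eq
    (by have := continuous_tent; fun_prop) integrable_tent h_int) 0
  rw [Real.fourierInv_eq, hF, tent_zero] at hinv
  simp only [inner_zero_right, AddChar.map_zero_eq_one, one_smul] at hinv
  have hinv' : ∫ v, tentHat (2 * π * v) = π := by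
    rw [integral_complex_ofReal] at hinv
    exact_mod_cast hinv
  rw [Measure.integral_comp_mul_left tentHat] at hinv'
  rw [abs_of_pos (by positivity), smul_eq_mul] at hinv'
  by_contra! h
  have : (2 * π)⁻¹ * ∫ v, tentHat v ≤ 0 :=
    mul_nonpos_of_nonneg_of_nonpos (by positivity) h
  linarith [pi_pos]

end Kernel

section ShortIntervals

open MeasureTheory Real

open ArithmeticFunction.vonMangoldt in
/-- `-ζ'/ζ(s) - 1/(s-1)`, continued to `re s ≥ 1`. -/
noncomputable def zetaAux (s : ℂ) : ℂ := LFunctionResidueClassAux (1 : ZMod 1) s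

lemma continuousOn_zetaAux : ContinuousOn zetaAux {s | 1 ≤ s.re} :=
  ArithmeticFunction.vonMangoldt.continuousOn_LFunctionResidueClassAux 1

/-- The L-series of the von Mangoldt function. -/
noncomputable def mangoldtSeries (s : ℂ) : ℂ :=
  LSeries (fun n => (ArithmeticFunction.vonMangoldt n : ℂ)) s

lemma residueClass_one_eq (n : ℕ) :
    ArithmeticFunction.vonMangoldt.residueClass (1 : ZMod 1) n
      = ArithmeticFunction.vonMangoldt n :=
  Set.indicator_of_mem (s := {n : ℕ | (n : ZMod 1) = 1}) (Subsingleton.elim (n : ZMod 1) 1) _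

lemma zetaAux_eq {s : ℂ} (hs : 1 < s.re) : zetaAux s = mangoldtSeries s - 1 / (s - 1) := by
  have := ArithmeticFunction.vonMangoldt.eqOn_LFunctionResidueClassAux (q := 1) (a := 1)
    isUnit_one hs
  simp only [residueClass_one_eq] at this
  rw [zetaAux, this]
  simp [mangoldtSeries]

lemma hasSum_tentHat {σ : ℝ} (hσ : 1 < σ) (c L : ℝ) :
    HasSum (fun n : ℕ => ArithmeticFunction.vonMangoldt n / (n : ℝ) ^ σ
        * tentHat (c * (log n - L)))
      (∫ t in (-π)..π, (tent t : ℂ) * (Complex.exp (c * t * L * Complex.I) *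
        mangoldtSeries (σ + c * t * Complex.I))).re := by
  have hct := continuous_tent
  have hre (t : ℝ) : ((σ : ℂ) + c * t * Complex.I).re = σ := by simp
  have hsum0 := ArithmeticFunction.LSeriesSummable_vonMangoldt (s := (σ : ℂ)) (by simpa using hσ)
  have hterm (n : ℕ) (t : ℝ) : (tent t : ℂ) * (Complex.exp (c * t * L * Complex.I) *
        LSeries.term (fun n => (ArithmeticFunction.vonMangoldt n : ℂ)) (σ + c * t * Complex.I) n)
      = ((ArithmeticFunction.vonMangoldt n / (n : ℝ) ^ σ : ℝ) : ℂ) *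
        ((tent t : ℂ) * Complex.exp (-(t * (c * (log n - L) : ℝ)) * Complex.I)) := by
    rcases eq_or_ne n 0 with rfl | hn
    · simp
    · have hn' : (0 : ℝ) < n := by positivity
      rw [LSeries.term_of_ne_zero hn, Complex.cpow_add _ _ (by exact_mod_cast hn),
        Complex.ofReal_div, Complex.ofReal_cpow hn'.le, Complex.ofReal_natCast]
      rw [Complex.cpow_def_of_ne_zero (x := (n : ℂ)) (y := c * t * Complex.I)
        (by exact_mod_cast hn)]
      have : Complex.exp (-(t * ((c * (log n - L) : ℝ) : ℂ)) * Complex.I)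
          = Complex.exp (c * t * L * Complex.I)
            * (Complex.exp ((log n : ℝ) * (c * t * Complex.I)))⁻¹ := by
        rw [← Complex.exp_neg, ← Complex.exp_add]
        congr 1
        push_cast
        ring
      rw [this, div_mul_eq_div_div, Complex.natCast_log]
      ring
  have hmain := intervalIntegral.hasSum_integral_of_dominated_convergence (a := -π) (b := π)
    (μ := volume)
    (F := fun n t => (tent t : ℂ) * (Complex.exp (c * t * L * Complex.I) *
        LSeries.term (fun n => (ArithmeticFunction.vonMangoldt n : ℂ)) (σ + c * t * Complex.I) n))
    (f := fun t => (tent t : ℂ) * (Complex.exp (c * t * L * Complex.I) *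
        mangoldtSeries (σ + c * t * Complex.I)))
    (fun n _ => (3 + π) *
      ‖LSeries.term (fun n => (ArithmeticFunction.vonMangoldt n : ℂ)) (σ : ℂ) n‖)
    (fun n => by
      simp_rw [hterm]
      exact (by fun_prop : Continuous _).aestronglyMeasurable)
    (fun n => Filter.Eventually.of_forall fun t _ => by
      rw [norm_mul, norm_mul]
      have h1 : ‖Complex.exp (c * t * L * Complex.I)‖ = 1 := by
        have := Complex.norm_exp_ofReal_mul_I (c * t * L)
        push_cast at this
        exact this
      rw [h1, one_mul, LSeries.norm_term_eq, LSeries.norm_term_eq, hre, Complex.ofReal_re,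
        Complex.norm_real, norm_eq_abs]
      gcongr
      exact abs_tent_le t)
    (Filter.Eventually.of_forall fun t _ => hsum0.norm.mul_left _)
    (by simp)
    (Filter.Eventually.of_forall fun t _ => by
      refine HasSum.mul_left _ (HasSum.mul_left _ ?_)
      exact (ArithmeticFunction.LSeriesSummable_vonMangoldt (by rw [hre]; exact hσ)).LSeriesHasSum)
  simp_rw [hterm, intervalIntegral.integral_const_mul, integral_tent_mul_cexp] at hmain
  have := Complex.hasSum_re hmain
  simpa only [← Complex.ofReal_mul, Complex.ofReal_re] using this

lemma integral_tentHat_eq {σ : ℝ} (hσ : 1 < σ) (c L : ℝ) :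
    ∫ t in (-π)..π, (tent t : ℂ) * (Complex.exp (c * t * L * Complex.I) *
        (1 / (σ + c * t * Complex.I - 1)))
      = ((∫ v in Set.Ioi (0 : ℝ), exp (-(σ - 1) * v) * tentHat (c * (v - L)) : ℝ) : ℂ) := by
  have hct := continuous_tent
  have h1 (t : ℝ) : (1 / (σ + c * t * Complex.I - 1) : ℂ)
      = ∫ v in Set.Ioi (0 : ℝ), Complex.exp (-(σ + c * t * Complex.I - 1) * v) := by
    rw [integral_exp_mul_complex_Ioi (by simpa using hσ)]
    rw [Complex.ofReal_zero, mul_zero, Complex.exp_zero, neg_div_neg_eq]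
  simp_rw [h1, ← integral_const_mul]
  rw [← integral_complex_ofReal]
  rw [intervalIntegral.integral_of_le (by linarith [pi_pos]), integral_integral_swap]
  · refine setIntegral_congr_fun measurableSet_Ioi fun v _ => ?_
    rw [← intervalIntegral.integral_of_le (by linarith [pi_pos]), Complex.ofReal_mul,
      ← integral_tent_mul_cexp, ← intervalIntegral.integral_const_mul]
    refine intervalIntegral.integral_congr fun t _ => ?_
    have h2 : Complex.exp (c * t * L * Complex.I)
        * Complex.exp (-(σ + c * t * Complex.I - 1) * v)
        = Complex.exp ((-(σ - 1) * v : ℝ) : ℂ)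
        * Complex.exp (-(t * ((c * (v - L) : ℝ) : ℂ)) * Complex.I) := by
      rw [← Complex.exp_add, ← Complex.exp_add]
      congr 1
      push_cast
      ring
    rw [Complex.ofReal_exp]
    linear_combination (tent t : ℂ) * h2
  · have h_int : Integrable (fun p : ℝ × ℝ => (3 + π) * exp (-(σ - 1) * p.2))
        ((volume.restrict (Set.Ioc (-π) π)).prod (volume.restrict (Set.Ioi 0))) := by
      refine Integrable.mul_prod (f := fun _ => 3 + π)
        (g := fun v => exp (-(σ - 1) * v)) (integrable_const _) ?_
      exact integrableOn_exp_mul_Ioi (by linarith) 0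
    refine h_int.mono' (by
      refine Continuous.aestronglyMeasurable ?_
      simp only [Function.uncurry_def]
      fun_prop) (Filter.Eventually.of_forall fun p => ?_)
    simp only [Function.uncurry_def]
    rw [norm_mul, norm_mul, Complex.norm_exp, Complex.norm_exp, Complex.norm_real, norm_eq_abs]
    have e1 : (c * p.1 * L * Complex.I : ℂ).re = 0 := by simp
    have e2 : (-(σ + c * p.1 * Complex.I - 1) * p.2 : ℂ).re = -(σ - 1) * p.2 := by simp
    rw [e1, e2, exp_zero, one_mul]
    gcongr
    exact abs_tent_le _

/-- The total von Mangoldt mass, weighted by `1/n`, of the non-primes `n ≥ m`. -/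
noncomputable def nonprimeTail (m : ℕ) : ℝ :=
  ∑' n : ℕ, if n < m then 0 else
    (if n.Prime then 0 else ArithmeticFunction.vonMangoldt n) / (n : ℝ)

lemma summable_nonprime :
    Summable fun n : ℕ => (if n.Prime then 0 else ArithmeticFunction.vonMangoldt n) / (n : ℝ) := by
  have := ArithmeticFunction.vonMangoldt.summable_residueClass_non_primes_div (1 : ZMod 1)
  simpa only [residueClass_one_eq] using this

lemma nonprime_nonneg (n : ℕ) :
    0 ≤ (if n.Prime then 0 else ArithmeticFunction.vonMangoldt n) / (n : ℝ) := by
  split_ifs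
  · simp
  · exact div_nonneg ArithmeticFunction.vonMangoldt_nonneg n.cast_nonneg

lemma summable_nonprimeTail (m : ℕ) :
    Summable fun n : ℕ => if n < m then 0 else
      (if n.Prime then 0 else ArithmeticFunction.vonMangoldt n) / (n : ℝ) := by
  refine Summable.of_nonneg_of_le (fun n => ?_) (fun n => ?_) summable_nonprime
  · split_ifs
    exacts [le_rfl, by simp, div_nonneg ArithmeticFunction.vonMangoldt_nonneg n.cast_nonneg]
  · by_cases h : n < m
    · rw [if_pos h]; exact nonprime_nonneg n
    · rw [if_neg h]

lemma tendsto_nonprimeTail : Filter.Tendsto nonprimeTail Filter.atTop (𝓝 0) := by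
  have h := summable_nonprime.hasSum.tendsto_sum_nat
  have h2 := (tendsto_const_nhds (x := ∑' n : ℕ,
    (if n.Prime then 0 else ArithmeticFunction.vonMangoldt n) / (n : ℝ))).sub h
  rw [sub_self] at h2
  refine h2.congr fun m => ?_
  rw [nonprimeTail, ← (summable_nonprimeTail m).sum_add_tsum_nat_add m,
    ← summable_nonprime.sum_add_tsum_nat_add m]
  have : ∑ i ∈ Finset.range m, (if i < m then 0 else
      (if i.Prime then 0 else ArithmeticFunction.vonMangoldt i) / (i : ℝ)) = 0 :=
    Finset.sum_eq_zero fun i hi => if_pos (Finset.mem_range.1 hi)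
  rw [this, zero_add, add_sub_cancel_left]
  refine tsum_congr fun i => ?_
  rw [if_neg (by omega : ¬ i + m < m)]

/-- If no prime has logarithm within `2 / c` of `L`, the smoothed prime count is small. -/
lemma re_integral_le {σ c L : ℝ} (hσ : 1 < σ) (hc : 0 < c)
    (hno : ¬ ∃ p : ℕ, p.Prime ∧ |c * (log p - L)| ≤ 2) :
    (∫ t in (-π)..π, (tent t : ℂ) * (Complex.exp (c * t * L * Complex.I) *
        mangoldtSeries (σ + c * t * Complex.I))).re
      ≤ (3 + π) * (2 * π) * nonprimeTail ⌊exp (L - 2 / c)⌋₊ := by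
  have h1 := hasSum_tentHat hσ c L
  have h2 := ((summable_nonprimeTail ⌊exp (L - 2 / c)⌋₊).hasSum).mul_left ((3 + π) * (2 * π))
  refine hasSum_le (fun n => ?_) h1 h2
  have hpos : 0 ≤ (3 + π) * (2 * π) := by positivity
  have hΛ : 0 ≤ ArithmeticFunction.vonMangoldt n / (n : ℝ) ^ σ :=
    div_nonneg ArithmeticFunction.vonMangoldt_nonneg (by positivity)
  have hrhs : 0 ≤ (3 + π) * (2 * π) * (if n < ⌊exp (L - 2 / c)⌋₊ then 0 else
      (if n.Prime then 0 else ArithmeticFunction.vonMangoldt n) / (n : ℝ)) := by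
    refine mul_nonneg hpos ?_
    by_cases h : n < ⌊exp (L - 2 / c)⌋₊
    · rw [if_pos h]
    · rw [if_neg h]; exact nonprime_nonneg n
  rcases le_or_gt 2 |c * (log n - L)| with h | h
  · exact (mul_nonpos_of_nonneg_of_nonpos hΛ (tentHat_nonpos h)).trans hrhs
  · have hnp : ¬ n.Prime := fun hp => hno ⟨n, hp, h.le⟩
    rcases Nat.eq_zero_or_pos n with rfl | hn
    · simp
    have hn1 : (1 : ℝ) ≤ n := by exact_mod_cast hn
    have hlow : ¬ n < ⌊exp (L - 2 / c)⌋₊ := by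
      intro hlt
      have h3 : (n : ℝ) < exp (L - 2 / c) := Nat.lt_of_lt_floor hlt
      rw [← log_lt_iff_lt_exp (by positivity)] at h3
      have h4 := (abs_lt.1 h).1
      have h5 : c * (log n - L) < c * (-(2 / c)) := by
        apply mul_lt_mul_of_pos_left _ hc
        linarith
      rw [mul_neg, mul_div_cancel₀ _ hc.ne'] at h5
      linarith
    rw [if_neg hlow, if_neg hnp, mul_comm]
    calc tentHat (c * (log n - L)) * (ArithmeticFunction.vonMangoldt n / (n : ℝ) ^ σ)
        ≤ (3 + π) * (2 * π) * (ArithmeticFunction.vonMangoldt n / (n : ℝ) ^ σ) := by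
          gcongr
          exact (le_abs_self _).trans (abs_tentHat_le _)
      _ ≤ (3 + π) * (2 * π) * (ArithmeticFunction.vonMangoldt n / (n : ℝ)) := by
          have : (n : ℝ) ≤ (n : ℝ) ^ σ := by
            simpa using rpow_le_rpow_of_exponent_le hn1 hσ.le
          have h6 : 0 ≤ ArithmeticFunction.vonMangoldt n := ArithmeticFunction.vonMangoldt_nonneg
          gcongr

/-- `zetaAux` on vertical lines, extended continuously to all of `ℝ²`. -/
lemma continuous_zetaAux_max (c : ℝ) :
    Continuous fun p : ℝ × ℝ => zetaAux ((max p.1 1 : ℝ) + c * p.2 * Complex.I) := by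
  refine continuousOn_zetaAux.comp_continuous (by fun_prop) fun p => ?_
  simp

lemma integral_mangoldtSeries_eq_add {σ : ℝ} (hσ : 1 < σ) (c L : ℝ) :
    ∫ t in (-π)..π, (tent t : ℂ) * (Complex.exp (c * t * L * Complex.I) *
        mangoldtSeries (σ + c * t * Complex.I))
      = (∫ t in (-π)..π, (tent t : ℂ) * (Complex.exp (c * t * L * Complex.I) *
        zetaAux ((max σ 1 : ℝ) + c * t * Complex.I)))
        + ∫ t in (-π)..π, (tent t : ℂ) * (Complex.exp (c * t * L * Complex.I) *
        (1 / (σ + c * t * Complex.I - 1))) := by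
  have hct := continuous_tent
  have hz := (continuous_zetaAux_max c).comp (by fun_prop : Continuous fun t : ℝ => (σ, t))
  simp only [Function.comp_def] at hz
  have hne (t : ℝ) : (σ + c * t * Complex.I - 1 : ℂ) ≠ 0 := by
    intro h
    have := congrArg Complex.re h
    simp at this
    linarith
  rw [← intervalIntegral.integral_add]
  · refine intervalIntegral.integral_congr fun t _ => ?_
    rw [max_eq_left hσ.le, zetaAux_eq (by simpa using hσ)]
    ring
  · exact (by fun_prop : Continuous _).intervalIntegrable _ _
  · refine Continuous.intervalIntegrable ?_ _ _
    have : Continuous fun t : ℝ => (1 / (σ + c * t * Complex.I - 1) : ℂ) :=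
      continuous_const.div (by fun_prop) hne
    fun_prop

lemma integral_comp_shift (c L : ℝ) :
    ∫ v in Set.Ioi (0 : ℝ), tentHat (c * (v - L)) = ∫ u in Set.Ioi (-L), tentHat (c * u) := by
  rw [← integral_indicator measurableSet_Ioi, ← integral_indicator measurableSet_Ioi,
    ← integral_sub_right_eq_self ((Set.Ioi (-L)).indicator fun u => tentHat (c * u)) L]
  refine integral_congr_ae (Filter.Eventually.of_forall fun v => ?_)
  simp [Set.indicator_apply]

/-- The limiting case `σ → 1` of the smoothed explicit formula, as an inequality. -/
lemma limit_inequality {c L : ℝ} (hc : 0 < c)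
    (hno : ¬ ∃ p : ℕ, p.Prime ∧ |c * (log p - L)| ≤ 2) :
    (∫ t in (-π)..π, (tent t : ℂ) * (Complex.exp (c * t * L * Complex.I) *
        zetaAux (1 + c * t * Complex.I))).re
      + ∫ u in Set.Ioi (-L), tentHat (c * u)
      ≤ (3 + π) * (2 * π) * nonprimeTail ⌊exp (L - 2 / c)⌋₊ := by
  have hct := continuous_tent
  have h_int : Integrable fun v => tentHat (c * (v - L)) :=
    (integrable_tentHat.comp_mul_left' hc.ne').comp_sub_right L
  have hlim1 : Filter.Tendsto (fun σ : ℝ => (∫ t in (-π)..π, (tent t : ℂ) *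
        (Complex.exp (c * t * L * Complex.I) *
        zetaAux ((max σ 1 : ℝ) + c * t * Complex.I)))) (𝓝[>] 1)
      (𝓝 (∫ t in (-π)..π, (tent t : ℂ) * (Complex.exp (c * t * L * Complex.I) *
        zetaAux (1 + c * t * Complex.I)))) := by
    have hz := continuous_zetaAux_max c
    have := (intervalIntegral.continuous_parametric_intervalIntegral_of_continuous'
      (f := fun σ t : ℝ => (tent t : ℂ) * (Complex.exp (c * t * L * Complex.I) *
        zetaAux ((max σ 1 : ℝ) + c * t * Complex.I))) (μ := volume)
      (by simp only [Function.uncurry_def]; fun_prop) (-π) π).tendsto 1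
    simp only [max_self, Complex.ofReal_one] at this
    exact this.mono_left nhdsWithin_le_nhds
  have hlim2 : Filter.Tendsto (fun σ : ℝ => ∫ v in Set.Ioi (0 : ℝ),
        exp (-(σ - 1) * v) * tentHat (c * (v - L))) (𝓝[>] 1)
      (𝓝 (∫ v in Set.Ioi (0 : ℝ), tentHat (c * (v - L)))) := by
    have hcc := continuous_tentHat
    refine tendsto_integral_filter_of_dominated_convergence
      (fun v => |tentHat (c * (v - L))|) (Filter.Eventually.of_forall fun σ =>
        (by fun_prop : Continuous _).aestronglyMeasurable) ?_ h_int.abs.integrableOn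
      (Filter.Eventually.of_forall fun v => ?_)
    · filter_upwards [self_mem_nhdsWithin] with σ hσ
      filter_upwards [ae_restrict_mem measurableSet_Ioi] with v hv
      rw [norm_mul, norm_eq_abs, norm_eq_abs, abs_exp]
      refine mul_le_of_le_one_left (abs_nonneg _) (exp_le_one_iff.2 ?_)
      have h1 : (1 : ℝ) < σ := hσ
      have h2 : (0 : ℝ) < v := hv
      nlinarith
    · have : Continuous fun σ : ℝ => exp (-(σ - 1) * v) * tentHat (c * (v - L)) := by fun_prop
      have := this.tendsto 1
      simp only [sub_self, neg_zero, zero_mul, exp_zero, one_mul] at this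
      exact this.mono_left nhdsWithin_le_nhds
  rw [← integral_comp_shift]
  refine le_of_tendsto (((Complex.continuous_re.tendsto _).comp hlim1).add hlim2) ?_
  filter_upwards [self_mem_nhdsWithin] with σ hσ
  have h := re_integral_le hσ hc hno
  rw [integral_mangoldtSeries_eq_add hσ, integral_tentHat_eq hσ, Complex.add_re,
    Complex.ofReal_re] at h
  exact h

lemma tendsto_integral_zetaAux {c : ℝ} (hc : 0 < c) :
    Filter.Tendsto (fun L : ℝ => ∫ t in (-π)..π, (tent t : ℂ) *
      (Complex.exp (c * t * L * Complex.I) * zetaAux (1 + c * t * Complex.I)))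
      Filter.atTop (𝓝 0) := by
  have hRL := Real.tendsto_integral_exp_smul_cocompact
    (fun t : ℝ => (tent t : ℂ) * zetaAux (1 + c * t * Complex.I))
  have hlin : Filter.Tendsto (fun L : ℝ => -(c / (2 * π)) * L) Filter.atTop
      (Filter.cocompact ℝ) := by
    have h1 : Filter.Tendsto (fun L : ℝ => -(c / (2 * π)) * L) Filter.atTop Filter.atBot :=
      Filter.tendsto_id.const_mul_atTop_of_neg (neg_lt_zero.2 (by positivity))
    exact h1.mono_right atBot_le_cocompact
  refine (hRL.comp hlin).congr fun L => ?_
  rw [← integral_tent_mul_eq_interval]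
  simp only [Function.comp_apply]
  refine integral_congr_ae (Filter.Eventually.of_forall fun t => ?_)
  simp only [Circle.smul_def, smul_eq_mul, Real.fourierChar_apply]
  rw [mul_left_comm]
  congr 3
  push_cast
  have : (π : ℂ) ≠ 0 := by exact_mod_cast pi_ne_zero
  field_simp

/-- Every sufficiently high window of fixed logarithmic length contains a prime. -/
theorem eventually_exists_prime_log_near {c : ℝ} (hc : 0 < c) :
    ∀ᶠ L : ℝ in Filter.atTop, ∃ p : ℕ, p.Prime ∧ |c * (log p - L)| ≤ 2 := by
  have hpos : 0 < ∫ u, tentHat (c * u) := by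
    rw [Measure.integral_comp_mul_left tentHat, smul_eq_mul]
    have := integral_tentHat_pos
    positivity
  have h_int : Integrable fun u => tentHat (c * u) := integrable_tentHat.comp_mul_left' hc.ne'
  have hl2 : Filter.Tendsto (fun L : ℝ => ∫ u in Set.Ioi (-L), tentHat (c * u)) Filter.atTop
      (𝓝 (∫ u, tentHat (c * u))) :=
    (aecover_Ioi Filter.tendsto_neg_atTop_atBot).integral_tendsto_of_countably_generated h_int
  have hl1 := (Complex.continuous_re.tendsto _).comp (tendsto_integral_zetaAux hc)
  have hfl : Filter.Tendsto (fun L : ℝ => ⌊exp (L - 2 / c)⌋₊) Filter.atTop Filter.atTop :=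
    tendsto_nat_floor_atTop.comp (tendsto_exp_atTop.comp
      (Filter.tendsto_atTop_add_const_right _ _ Filter.tendsto_id))
  have hr := (tendsto_nonprimeTail.comp hfl).const_mul ((3 + π) * (2 * π))
  have hl := hl1.add hl2
  rw [Complex.zero_re, zero_add] at hl
  rw [mul_zero] at hr
  filter_upwards [hr.eventually_lt hl hpos] with L hL
  by_contra hno
  exact absurd (limit_inequality hc hno) (not_le.2 hL)

end ShortIntervals

section LeastPrime

/-- Every long enough interval `[x, (1 + ε) x]` contains a prime. -/
lemma eventually_exists_prime_near {ε : ℝ} (hε : 0 < ε) :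
    ∀ᶠ x : ℝ in atTop, ∃ p : ℕ, p.Prime ∧ x ≤ p ∧ p ≤ (1 + ε) * x := by
  have hlog : 0 < Real.log (1 + ε) := Real.log_pos (by linarith)
  have hc : 0 < 4 / Real.log (1 + ε) := by positivity
  have hlim : Tendsto (fun x : ℝ => Real.log x + Real.log (1 + ε) / 2) atTop atTop :=
    tendsto_atTop_add_const_right _ _ Real.tendsto_log_atTop
  filter_upwards [hlim.eventually (eventually_exists_prime_log_near hc), eventually_gt_atTop 0]
    with x hx hx0
  obtain ⟨p, hp, hpx⟩ := hx
  have hp0 : (0 : ℝ) < p := by exact_mod_cast hp.pos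
  have h1 : |Real.log p - (Real.log x + Real.log (1 + ε) / 2)| ≤ Real.log (1 + ε) / 2 := by
    rw [abs_mul, abs_of_pos hc, div_mul_eq_mul_div, div_le_iff₀ hlog] at hpx
    linarith
  obtain ⟨h2, h3⟩ := abs_le.1 h1
  refine ⟨p, hp, (Real.log_le_log_iff hx0 hp0).1 (by linarith), ?_⟩
  rw [← Real.log_le_log_iff hp0 (by positivity), Real.log_mul (by positivity) hx0.ne']
  linarith

lemma leastPrime_mem (x : ℝ) : (leastPrime x).Prime ∧ x ≤ leastPrime x := by
  obtain ⟨p, hpx, hp⟩ := Nat.exists_infinite_primes ⌈x⌉₊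
  exact Nat.sInf_mem (s := {p : ℕ | p.Prime ∧ x ≤ (p : ℝ)}) ⟨p, hp, Nat.ceil_le.1 hpx⟩

lemma leastPrime_le {x : ℝ} {p : ℕ} (hp : p.Prime) (hx : x ≤ p) : leastPrime x ≤ p :=
  Nat.sInf_le ⟨hp, hx⟩

lemma tendsto_leastPrime_div {y : ℝ} (hy : 0 < y) :
    Tendsto (fun X : ℝ => (leastPrime (y * X) : ℝ) / X) atTop (𝓝 y) := by
  refine tendsto_order.2 ⟨fun a ha => ?_, fun a ha => ?_⟩
  · filter_upwards [eventually_gt_atTop 0] with X hX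
    rw [lt_div_iff₀ hX]
    exact (mul_lt_mul_of_pos_right ha hX).trans_le (leastPrime_mem _).2
  · have hε : 0 < (a - y) / (2 * y) := div_pos (by linarith) (by positivity)
    have hlim : Tendsto (fun X : ℝ => y * X) atTop atTop := tendsto_id.const_mul_atTop hy
    filter_upwards [eventually_gt_atTop 0, hlim.eventually (eventually_exists_prime_near hε)]
      with X hX ⟨p, hp, h1, h2⟩
    rw [div_lt_iff₀ hX]
    have h3 : (leastPrime (y * X) : ℝ) ≤ p := by exact_mod_cast leastPrime_le hp h1
    have h4 : (1 + (a - y) / (2 * y)) * (y * X) = (y + a) / 2 * X := by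
      field_simp
      ring
    rw [h4] at h2
    nlinarith

end LeastPrime

section Totient

lemma inv_card_add_one_le_prod {s : Finset ℕ} (hs : ∀ p ∈ s, 2 ≤ p) :
    1 / ((#s : ℝ) + 1) ≤ ∏ p ∈ s, (1 - (p : ℝ)⁻¹) := by
  induction s using Finset.induction_on_max with
  | empty => simp
  | insert m s hm ih =>
    have hms : m ∉ s := fun h => (hm m h).false
    have hcard : #s + 2 ≤ m := by
      have hm2 := hs m (Finset.mem_insert_self _ _)
      have hsub : s ⊆ Finset.Ico 2 m := fun p hp =>
        Finset.mem_Ico.2 ⟨hs p (Finset.mem_insert_of_mem hp), hm p hp⟩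
      have := Finset.card_le_card hsub
      rw [Nat.card_Ico] at this
      omega
    have hcard' : (#s : ℝ) + 2 ≤ m := by exact_mod_cast hcard
    have h0 : (0 : ℝ) ≤ #s := by positivity
    rw [Finset.prod_insert hms, Finset.card_insert_of_notMem hms]
    have h1 : (m : ℝ)⁻¹ ≤ 1 / ((#s : ℝ) + 2) := by
      rw [inv_eq_one_div]
      gcongr
    calc 1 / (((#s + 1 : ℕ) : ℝ) + 1)
        = (1 - 1 / ((#s : ℝ) + 2)) * (1 / ((#s : ℝ) + 1)) := by
          push_cast
          field_simp
          ring
      _ ≤ (1 - (m : ℝ)⁻¹) * ∏ p ∈ s, (1 - (p : ℝ)⁻¹) := by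
          have h2 := ih fun p hp => hs p (Finset.mem_insert_of_mem hp)
          have h3 : 1 / ((#s : ℝ) + 2) ≤ 1 := by
            rw [div_le_one (by positivity)]
            linarith
          have h4 : (0 : ℝ) ≤ 1 / ((#s : ℝ) + 1) := by positivity
          gcongr
          linarith

lemma totient_div_self_ge {n : ℕ} (hn : n ≠ 0) :
    1 / (2 * Real.log n + 1) ≤ (n.totient : ℝ) / n := by
  have hn0 : (0 : ℝ) < n := by positivity
  have h1 : (n.totient : ℝ) = n * ∏ p ∈ n.primeFactors, (1 - (p : ℝ)⁻¹) := by
    have h := congrArg (Rat.cast (K := ℝ)) (Nat.totient_eq_mul_prod_factors n)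
    push_cast at h
    exact h
  rw [h1, mul_div_cancel_left₀ _ hn0.ne']
  refine le_trans ?_ (inv_card_add_one_le_prod fun p hp => (Nat.prime_of_mem_primeFactors hp).two_le)
  have h2 : 2 ^ #n.primeFactors ≤ n :=
    (Finset.pow_card_le_prod _ _ _ fun p hp => (Nat.prime_of_mem_primeFactors hp).two_le).trans
      (Nat.le_of_dvd (Nat.pos_of_ne_zero hn) (Nat.prod_primeFactors_dvd n))
  have h3 : (#n.primeFactors : ℝ) * Real.log 2 ≤ Real.log n := by
    rw [← Real.log_pow]
    exact Real.log_le_log (by positivity) (by exact_mod_cast h2)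
  have h4 : (#n.primeFactors : ℝ) ≤ 2 * Real.log n := by
    nlinarith [Real.log_two_gt_d9, (Nat.cast_nonneg #n.primeFactors : (0 : ℝ) ≤ _)]
  gcongr

lemma totient_div_self_le_one (n : ℕ) : (n.totient : ℝ) / n ≤ 1 :=
  div_le_one_of_le₀ (by exact_mod_cast n.totient_le) n.cast_nonneg

end Totient

section Conductors

lemma memS_sq {n : ℕ} (hn : n ≠ 0) : memS (n ^ 2) := by
  refine ⟨by positivity, ?_, Or.inr fun p hp hpn => pow_dvd_pow_of_dvd (hp.dvd_of_dvd_pow hpn) 2⟩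
  have h : n % 4 < 4 := Nat.mod_lt _ (by norm_num)
  rw [Nat.pow_mod]
  interval_cases n % 4 <;> norm_num

lemma fS_sub_fS {X Y : ℝ} (h : X ≤ Y) :
    fS Y - fS X = ∑ N ∈ (Finset.range (⌊Y⌋₊ + 1)).filter
      (fun N : ℕ => memS N ∧ X < (N : ℝ) ∧ (N : ℝ) ≤ Y), (N.totient : ℝ) / N := by
  have hsub : (Finset.range (⌊X⌋₊ + 1)).filter (fun N : ℕ => memS N ∧ (N : ℝ) ≤ X)
      ⊆ (Finset.range (⌊Y⌋₊ + 1)).filter (fun N : ℕ => memS N ∧ (N : ℝ) ≤ Y) := by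
    intro N hN
    simp only [Finset.mem_filter, Finset.mem_range, Nat.lt_succ_iff] at hN ⊢
    exact ⟨hN.1.trans (Nat.floor_le_floor h), hN.2.1, hN.2.2.trans h⟩
  rw [fS, fS, ← Finset.sum_sdiff hsub, add_sub_cancel_right]
  refine Finset.sum_congr (Finset.ext fun N => ?_) fun _ _ => rfl
  simp only [Finset.mem_sdiff, Finset.mem_filter, Finset.mem_range, Nat.lt_succ_iff, not_and,
    not_le]
  constructor
  · rintro ⟨⟨h1, h2, h3⟩, h4⟩
    refine ⟨h1, h2, ?_, h3⟩
    by_contra! h5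
    exact absurd (h4 (Nat.le_floor h5) h2) (not_lt.2 h5)
  · rintro ⟨h1, h2, h3, h4⟩
    exact ⟨⟨h1, h2, h4⟩, fun _ _ => h3⟩

/-- A lower bound for the weight of an interval, from its perfect squares. -/
lemma fS_sub_fS_ge {X Y : ℝ} (hX : 1 ≤ X) (h : X ≤ Y) :
    (√Y - √X - 1) / (2 * Real.log Y + 1) ≤ fS Y - fS X := by
  have hY : 1 ≤ Y := hX.trans h
  have hlog : 0 ≤ Real.log Y := Real.log_nonneg hY
  have hsub : (Finset.Ioc ⌊√X⌋₊ ⌊√Y⌋₊).image (fun n : ℕ => n ^ 2) ⊆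
      (Finset.range (⌊Y⌋₊ + 1)).filter (fun N : ℕ => memS N ∧ X < (N : ℝ) ∧ (N : ℝ) ≤ Y) := by
    intro N hN
    obtain ⟨n, hn, rfl⟩ := Finset.mem_image.1 hN
    obtain ⟨h1, h2⟩ := Finset.mem_Ioc.1 hn
    have h3 : √X < n := (Nat.floor_lt (Real.sqrt_nonneg _)).1 h1
    have h4 : (n : ℝ) ≤ √Y := (Nat.le_floor_iff (Real.sqrt_nonneg _)).1 h2
    have h5 : ((n ^ 2 : ℕ) : ℝ) ≤ Y := by
      push_cast
      exact (Real.le_sqrt (by positivity) (by linarith)).1 h4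
    simp only [Finset.mem_filter, Finset.mem_range, Nat.lt_succ_iff]
    refine ⟨Nat.le_floor h5, memS_sq (by omega), ?_, h5⟩
    push_cast
    exact (Real.sqrt_lt' (by linarith [Real.sqrt_nonneg X])).1 h3
  rw [fS_sub_fS h]
  have hcard : √Y - √X - 1 ≤ #((Finset.Ioc ⌊√X⌋₊ ⌊√Y⌋₊).image fun n : ℕ => n ^ 2) := by
    rw [Finset.card_image_of_injective _ (Nat.pow_left_injective (by norm_num)), Nat.card_Ioc,
      Nat.cast_sub (Nat.floor_le_floor (Real.sqrt_le_sqrt h))]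
    linarith [Nat.lt_floor_add_one √Y, Nat.floor_le (Real.sqrt_nonneg X)]
  calc (√Y - √X - 1) / (2 * Real.log Y + 1)
      ≤ #((Finset.Ioc ⌊√X⌋₊ ⌊√Y⌋₊).image fun n : ℕ => n ^ 2) * (1 / (2 * Real.log Y + 1)) := by
        rw [mul_one_div]
        gcongr
    _ ≤ ∑ N ∈ (Finset.Ioc ⌊√X⌋₊ ⌊√Y⌋₊).image (fun n : ℕ => n ^ 2), (N.totient : ℝ) / N := by
        rw [← nsmul_eq_mul]
        refine Finset.card_nsmul_le_sum _ _ _ fun N hN => ?_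
        obtain ⟨-, h1, -, h2⟩ := Finset.mem_filter.1 (hsub hN)
        have hN0 : (0 : ℝ) < N := by exact_mod_cast h1.1
        refine le_trans ?_ (totient_div_self_ge h1.1.ne')
        have hN1 : 0 ≤ Real.log N := Real.log_natCast_nonneg N
        gcongr
    _ ≤ _ := Finset.sum_le_sum_of_subset_of_nonneg hsub fun _ _ _ => by positivity

lemma tendsto_fS_sub_fS {δ : ℝ} (hδ : δ ∈ Set.Ioo (1 / 2 : ℝ) 1) :
    Tendsto (fun X : ℝ => fS (X + X ^ δ) - fS X) atTop atTop := by
  obtain ⟨hδ1, hδ2⟩ := hδ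
  set η : ℝ := (δ - 1 / 2) / 2 with hη
  have hη0 : 0 < η := by rw [hη]; linarith
  have hη1 : η ≤ 1 := by rw [hη]; linarith
  have hC : 0 < 4 / η + 1 := by positivity
  have hlim : Tendsto (fun X : ℝ => (X ^ η / 3 - 1) / (4 / η + 1)) atTop atTop := by
    refine Tendsto.atTop_div_const hC (tendsto_atTop_add_const_right _ _ ?_)
    exact (tendsto_rpow_atTop hη0).atTop_div_const (by norm_num)
  refine tendsto_atTop_mono' _ ?_ hlim
  filter_upwards [eventually_ge_atTop (1 : ℝ), (tendsto_rpow_atTop hη0).eventually_ge_atTop 3]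
    with X hX hX3
  have hX0 : 0 < X := by linarith
  have hXδ : X ^ δ ≤ X := by simpa using Real.rpow_le_rpow_of_exponent_le hX hδ2.le
  have hXδ0 : 0 < X ^ δ := by positivity
  have hXη : 1 ≤ X ^ η := Real.one_le_rpow hX hη0.le
  have hlog : 2 * Real.log (X + X ^ δ) + 1 ≤ (4 / η + 1) * X ^ η := by
    have h1 : Real.log (X + X ^ δ) ≤ Real.log (2 * X) :=
      Real.log_le_log (by positivity) (by linarith)
    have h2 := Real.log_le_rpow_div (by positivity : 0 ≤ 2 * X) hη0
    have h3 : (2 * X) ^ η ≤ 2 * X ^ η := by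
      rw [Real.mul_rpow (by norm_num) hX0.le]
      gcongr
      simpa using Real.rpow_le_rpow_of_exponent_le (by norm_num : (1 : ℝ) ≤ 2) hη1
    have h4 : (2 * X) ^ η / η ≤ 2 * X ^ η / η := by gcongr
    have h5 : 2 * (2 * X ^ η / η) = 4 / η * X ^ η := by ring
    linarith
  have hsqrt : X ^ η * X ^ η / 3 ≤ √(X + X ^ δ) - √X := by
    have h1 : X ^ η * X ^ η * √X = X ^ δ := by
      rw [Real.sqrt_eq_rpow, ← Real.rpow_add hX0, ← Real.rpow_add hX0]
      congr 1
      rw [hη]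
      ring
    have h2 : √(X + X ^ δ) ≤ 2 * √X := by
      rw [Real.sqrt_le_left (by positivity), mul_pow, Real.sq_sqrt hX0.le]
      linarith
    have h3 := Real.sq_sqrt hX0.le
    have h4 := Real.sq_sqrt (by positivity : 0 ≤ X + X ^ δ)
    have h5 : √X < √(X + X ^ δ) := Real.sqrt_lt_sqrt hX0.le (by linarith)
    have h6 : 0 < √X := Real.sqrt_pos.2 hX0
    have h7 : X ^ η * X ^ η * √X = (√(X + X ^ δ) - √X) * (√(X + X ^ δ) + √X) := by
      rw [h1]
      linear_combination h3 - h4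
    have h8 : X ^ η * X ^ η * √X ≤ (√(X + X ^ δ) - √X) * (3 * √X) := by
      rw [h7]
      exact mul_le_mul_of_nonneg_left (by linarith) (by linarith)
    nlinarith
  refine le_trans ?_ (fS_sub_fS_ge hX (by linarith))
  have hlog0 : 0 < 2 * Real.log (X + X ^ δ) + 1 := by
    have := Real.log_nonneg (by linarith : 1 ≤ X + X ^ δ)
    linarith
  rw [div_le_div_iff₀ hC hlog0]
  calc (X ^ η / 3 - 1) * (2 * Real.log (X + X ^ δ) + 1)
      ≤ (X ^ η / 3 - 1) * ((4 / η + 1) * X ^ η) := by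
        gcongr
        linarith
    _ = (X ^ η * X ^ η / 3 - X ^ η) * (4 / η + 1) := by ring
    _ ≤ (√(X + X ^ δ) - √X - 1) * (4 / η + 1) := by gcongr

end Conductors

section Murmuration

/-- The sum over even primitive characters mod `N`, compared with its main term. -/
lemma norm_finsum_even_primitive_sub_le {N p : ℕ} (hp : p.Prime) (hN : memS N) (hN1 : N ≠ 1)
    (hNp : N < p ^ 2) :
    ‖∑ᶠ χ ∈ {χ : DirichletCharacter ℂ N | χ.IsPrimitive ∧ χ (-1) = 1},
        χ ((p : ℕ) : ZMod N) / gaussSum' χ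
      - ((N.totient / N * Real.cos (2 * Real.pi * (p / N)) : ℝ) : ℂ)‖
      ≤ 1 / N + if N = p then 1 else 0 := by
  have : NeZero N := ⟨hN.1.ne'⟩
  have hN0 : (0 : ℝ) ≤ 1 / N := by positivity
  obtain ⟨-, -, hNpr | hNsq⟩ := hN
  · rcases eq_or_ne N p with rfl | hne
    · rw [finsum_even_primitive_self hN1, zero_sub, norm_neg, Complex.norm_real, norm_mul,
        if_pos rfl, Real.norm_of_nonneg (by positivity)]
      have h1 : (N.totient : ℝ) / N * ‖Real.cos (2 * Real.pi * (N / N))‖ ≤ 1 :=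
        mul_le_one₀ (totient_div_self_le_one N) (norm_nonneg _) (Real.abs_cos_le_one _)
      linarith
    · rw [finsum_even_primitive_of_prime hNpr ((Nat.coprime_primes hp hNpr).2 hne.symm),
        ← Complex.ofReal_sub, Complex.norm_real, add_sub_cancel_left, if_neg hne, add_zero,
        Real.norm_of_nonneg hN0]
  · have hcop : p.Coprime N := (Nat.Prime.coprime_iff_not_dvd hp).2 fun h =>
      absurd (Nat.le_of_dvd (Nat.pos_of_neZero N) (hNsq p hp h)) (not_le.2 hNp)
    rw [finsum_even_primitive_of_isSquarefull hNsq hcop, sub_self, norm_zero]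
    split_ifs <;> linarith

/-- The conductors in `S` between `X` and `Y`, both ends included. -/
noncomputable def conductors (X Y : ℝ) : Finset ℕ :=
  (Finset.range (⌊Y⌋₊ + 1)).filter (fun N : ℕ => memS N ∧ X ≤ (N : ℝ) ∧ (N : ℝ) ≤ Y)

lemma card_conductors_le {X Y : ℝ} (h : X ≤ Y) (hX : 0 ≤ X) :
    (#(conductors X Y) : ℝ) ≤ Y - X + 1 := by
  have hsub : conductors X Y ⊆ Finset.Ico ⌈X⌉₊ (⌊Y⌋₊ + 1) := by
    intro N hN
    obtain ⟨h1, -, h2, -⟩ := Finset.mem_filter.1 hN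
    exact Finset.mem_Ico.2 ⟨Nat.ceil_le.2 h2, Finset.mem_range.1 h1⟩
  rcases (conductors X Y).eq_empty_or_nonempty with he | ⟨N, hN⟩
  · rw [he]
    simp only [Finset.card_empty, Nat.cast_zero]
    linarith
  have hle : ⌈X⌉₊ ≤ ⌊Y⌋₊ + 1 := by
    obtain ⟨h1, h2⟩ := Finset.mem_Ico.1 (hsub hN)
    omega
  have h1 := Finset.card_le_card hsub
  rw [Nat.card_Ico] at h1
  have h2 : (#(conductors X Y) : ℝ) ≤ (⌊Y⌋₊ + 1 - ⌈X⌉₊ : ℝ) := by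
    rw [← Nat.cast_add_one, ← Nat.cast_sub hle]
    exact_mod_cast h1
  linarith [Nat.floor_le (hX.trans h), Nat.le_ceil X]

lemma sum_conductors_sub_mem_Icc {X Y : ℝ} (h : X ≤ Y) :
    ∑ N ∈ conductors X Y, (N.totient : ℝ) / N - (fS Y - fS X) ∈ Set.Icc (0 : ℝ) 1 := by
  have hsub : (Finset.range (⌊Y⌋₊ + 1)).filter
      (fun N : ℕ => memS N ∧ X < (N : ℝ) ∧ (N : ℝ) ≤ Y) ⊆ conductors X Y := by
    intro N hN
    obtain ⟨h1, h2, h3, h4⟩ := Finset.mem_filter.1 hN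
    exact Finset.mem_filter.2 ⟨h1, h2, h3.le, h4⟩
  rw [fS_sub_fS h, ← Finset.sum_sdiff hsub, add_sub_cancel_right]
  refine ⟨Finset.sum_nonneg fun _ _ => by positivity, ?_⟩
  have hsingle : conductors X Y \ (Finset.range (⌊Y⌋₊ + 1)).filter
      (fun N : ℕ => memS N ∧ X < (N : ℝ) ∧ (N : ℝ) ≤ Y) ⊆ {⌊X⌋₊} := by
    intro N hN
    obtain ⟨hN1, hN2⟩ := Finset.mem_sdiff.1 hN
    obtain ⟨h1, h2, h3, h4⟩ := Finset.mem_filter.1 hN1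
    have h5 : (N : ℝ) = X := by
      by_contra hne
      exact hN2 (Finset.mem_filter.2 ⟨h1, h2, lt_of_le_of_ne h3 (Ne.symm hne), h4⟩)
    rw [Finset.mem_singleton, ← h5, Nat.floor_natCast]
  refine (Finset.sum_le_sum_of_subset_of_nonneg hsingle fun _ _ _ => by positivity).trans ?_
  rw [Finset.sum_singleton]
  exact totient_div_self_le_one _

/-- The murmuration sum over conductors in `[X, Y]`. -/
noncomputable def murmurationSum (p : ℕ) (X Y : ℝ) : ℂ :=
  ∑ N ∈ conductors X Y, ∑ᶠ χ ∈ {χ : DirichletCharacter ℂ N | χ.IsPrimitive ∧ χ (-1) = 1},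
    χ ((p : ℕ) : ZMod N) / gaussSum' χ

lemma norm_murmurationSum_sub_le {p : ℕ} {X Y y : ℝ} (hp : p.Prime) (hX : 1 < X) (h : X ≤ Y)
    (hYp : Y < (p : ℝ) ^ 2) :
    ‖murmurationSum p X Y - ((Real.cos (2 * Real.pi * y) * (fS Y - fS X) : ℝ) : ℂ)‖
      ≤ ((Y - X + 1) / X + 1) + 2 * Real.pi * (p / X * ((Y - X) / X) + |p / X - y|)
        * (fS Y - fS X + 1) + 1 := by
  have hX0 : 0 < X := by linarith
  obtain ⟨hW0, hW1⟩ := sum_conductors_sub_mem_Icc h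
  set W := ∑ N ∈ conductors X Y, (N.totient : ℝ) / N with hW
  set E := 2 * Real.pi * (p / X * ((Y - X) / X) + |p / X - y|) with hE
  have hE0 : 0 ≤ E := by
    have : 0 ≤ Y - X := by linarith
    positivity
  have hmem {N : ℕ} (hN : N ∈ conductors X Y) : memS N ∧ X ≤ N ∧ N ≤ Y :=
    (Finset.mem_filter.1 hN).2
  have hterm : ∀ N ∈ conductors X Y,
      ‖∑ᶠ χ ∈ {χ : DirichletCharacter ℂ N | χ.IsPrimitive ∧ χ (-1) = 1},
        χ ((p : ℕ) : ZMod N) / gaussSum' χ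
      - ((N.totient / N * Real.cos (2 * Real.pi * (p / N)) : ℝ) : ℂ)‖
      ≤ 1 / X + if N = p then 1 else 0 := by
    intro N hN
    obtain ⟨h1, h2, h3⟩ := hmem hN
    refine (norm_finsum_even_primitive_sub_le hp h1 ?_ ?_).trans ?_
    · rintro rfl
      norm_num at h2
      linarith
    · exact_mod_cast h3.trans_lt hYp
    · gcongr
  have hcos : ∀ N ∈ conductors X Y,
      ‖((N.totient / N * (Real.cos (2 * Real.pi * (p / N)) - Real.cos (2 * Real.pi * y)) : ℝ) : ℂ)‖
      ≤ N.totient / N * E := by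
    intro N hN
    obtain ⟨h1, h2, h3⟩ := hmem hN
    have hN0 : (0 : ℝ) < N := by linarith
    rw [Complex.norm_real, norm_mul, Real.norm_of_nonneg (by positivity)]
    gcongr
    have h4 : |(p : ℝ) / N - p / X| ≤ p / X * ((Y - X) / X) := by
      have h5 : (p : ℝ) / N - p / X = -(p / X * ((N - X) / N)) := by
        field_simp
        ring
      have h6 : 0 ≤ (N : ℝ) - X := by linarith
      rw [h5, abs_neg, abs_of_nonneg (by positivity)]
      gcongr
    calc ‖Real.cos (2 * Real.pi * (p / N)) - Real.cos (2 * Real.pi * y)‖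
        ≤ |2 * Real.pi * (p / N) - 2 * Real.pi * y| := Real.abs_cos_sub_cos_le _ _
      _ = 2 * Real.pi * |(p : ℝ) / N - y| := by
          rw [← mul_sub, abs_mul, abs_of_pos Real.two_pi_pos]
      _ ≤ E := by
          rw [hE]
          gcongr
          exact (abs_sub_le _ (p / X : ℝ) _).trans (by gcongr)
  have hsplit : murmurationSum p X Y - ((Real.cos (2 * Real.pi * y) * (fS Y - fS X) : ℝ) : ℂ)
      = ∑ N ∈ conductors X Y,
        (∑ᶠ χ ∈ {χ : DirichletCharacter ℂ N | χ.IsPrimitive ∧ χ (-1) = 1},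
          χ ((p : ℕ) : ZMod N) / gaussSum' χ
          - ((N.totient / N * Real.cos (2 * Real.pi * (p / N)) : ℝ) : ℂ))
      + ∑ N ∈ conductors X Y, ((N.totient / N *
          (Real.cos (2 * Real.pi * (p / N)) - Real.cos (2 * Real.pi * y)) : ℝ) : ℂ)
      + ((Real.cos (2 * Real.pi * y) * (W - (fS Y - fS X)) : ℝ) : ℂ) := by
    rw [murmurationSum, Finset.sum_sub_distrib, ← Complex.ofReal_sum, ← Complex.ofReal_sum]
    simp only [mul_sub, Finset.sum_sub_distrib, ← Finset.sum_mul, ← hW]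
    push_cast
    ring
  rw [hsplit]
  refine (norm_add₃_le).trans (add_le_add (add_le_add ?_ ?_) ?_)
  · refine (norm_sum_le_of_le _ hterm).trans ?_
    rw [Finset.sum_add_distrib, Finset.sum_const, nsmul_eq_mul, Finset.sum_ite_eq', mul_one_div]
    gcongr
    · exact card_conductors_le h hX0.le
    · split_ifs <;> norm_num
  · refine (norm_sum_le_of_le _ hcos).trans ?_
    rw [← Finset.sum_mul, ← hW, mul_comm]
    gcongr
    linarith
  · rw [Complex.norm_real, norm_mul, Real.norm_of_nonneg hW0]
    exact mul_le_one₀ (Real.abs_cos_le_one _) hW0 hW1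

end Murmuration

theorem murmuration_special_conductors (hRH : RiemannHypothesis') (y δ : ℝ)
    (hy : 0 < y) (hδ : δ ∈ Set.Ioo (1 / 2 : ℝ) 1) :
    Tendsto
      (fun X : ℝ => (Complex.ofReal (1 / (fS (X + X ^ δ) - fS X))) *
        ∑ N ∈ (Finset.range (Nat.floor (X + X ^ δ) + 1)).filter
            (fun N : ℕ => memS N ∧ X ≤ (N : ℝ) ∧ (N : ℝ) ≤ X + X ^ δ),
          ∑ᶠ χ ∈ {χ : DirichletCharacter ℂ N | χ.IsPrimitive ∧ χ (-1) = 1},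
            χ ((leastPrime (y * X) : ℕ) : ZMod N) / gaussSum' χ)
      atTop (𝓝 (Complex.ofReal (Real.cos (2 * Real.pi * y)))) := by
  change Tendsto (fun X : ℝ => (Complex.ofReal (1 / (fS (X + X ^ δ) - fS X))) *
    murmurationSum (leastPrime (y * X)) X (X + X ^ δ)) atTop _
  have hD := tendsto_fS_sub_fS hδ
  have hq := tendsto_leastPrime_div hy
  have hpow : Tendsto (fun X : ℝ => X ^ δ / X) atTop (𝓝 0) := by
    refine (tendsto_rpow_neg_atTop (y := 1 - δ) (by linarith [hδ.2])).congr' ?_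
    filter_upwards [eventually_gt_atTop 0] with X hX
    rw [neg_sub, Real.rpow_sub_one hX.ne']
  have hE : Tendsto (fun X : ℝ => 2 * Real.pi * ((leastPrime (y * X) : ℝ) / X * (X ^ δ / X)
      + |(leastPrime (y * X) : ℝ) / X - y|)) atTop (𝓝 0) := by
    have := (((hq.mul hpow).add (hq.sub_const y).abs)).const_mul (2 * Real.pi)
    simpa using this
  have hone : Tendsto (fun X : ℝ => 1 / (fS (X + X ^ δ) - fS X)) atTop (𝓝 0) :=
    hD.const_div_atTop 1
  have hbound := (hone.mul_const 4).add (hE.mul (hone.const_add 1))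
  simp only [zero_mul, add_zero] at hbound
  refine tendsto_iff_norm_sub_tendsto_zero.2 (squeeze_zero' (.of_forall fun _ => norm_nonneg _) ?_
    hbound)
  filter_upwards [hD.eventually_gt_atTop 0, eventually_gt_atTop (1 : ℝ),
    eventually_gt_atTop (2 / y ^ 2)] with X hDX hX1 hXy
  have hX0 : 0 < X := by linarith
  have hXδ : X ^ δ ≤ X := by simpa using Real.rpow_le_rpow_of_exponent_le hX1.le hδ.2.le
  have hXδ0 : 0 < X ^ δ := by positivity
  obtain ⟨hp, hyp⟩ := leastPrime_mem (y * X)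
  have hYp : X + X ^ δ < (leastPrime (y * X) : ℝ) ^ 2 := by
    rw [div_lt_iff₀ (by positivity)] at hXy
    calc X + X ^ δ ≤ 2 * X := by linarith
      _ < X * y ^ 2 * X := by gcongr
      _ = (y * X) ^ 2 := by ring
      _ ≤ (leastPrime (y * X) : ℝ) ^ 2 := by gcongr
  have hmain := norm_murmurationSum_sub_le (y := y) hp hX1 (by linarith : X ≤ X + X ^ δ) hYp
  set D := fS (X + X ^ δ) - fS X with hDdef
  rw [add_sub_cancel_left] at hmain
  have hfirst : (X ^ δ + 1) / X ≤ 2 := by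
    rw [div_le_iff₀ hX0]
    linarith
  have hfactor : Complex.ofReal (1 / D) * murmurationSum (leastPrime (y * X)) X (X + X ^ δ)
      - Complex.ofReal (Real.cos (2 * Real.pi * y))
      = Complex.ofReal (1 / D) * (murmurationSum (leastPrime (y * X)) X (X + X ^ δ)
        - ((Real.cos (2 * Real.pi * y) * D : ℝ) : ℂ)) := by
    have : (D : ℂ) ≠ 0 := by exact_mod_cast hDX.ne'
    push_cast
    field_simp
  rw [hfactor, norm_mul, Complex.norm_real, Real.norm_of_nonneg (by positivity)]
  refine (mul_le_mul_of_nonneg_left hmain (by positivity)).trans ?_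
  set E := 2 * Real.pi * ((leastPrime (y * X) : ℝ) / X * (X ^ δ / X)
      + |(leastPrime (y * X) : ℝ) / X - y|)
  calc 1 / D * ((X ^ δ + 1) / X + 1 + E * (D + 1) + 1)
      ≤ 1 / D * (2 + 1 + E * (D + 1) + 1) := by gcongr
    _ = 1 / D * 4 + E * (1 + 1 / D) := by
        field_simp
        ring
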